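/- Let n ≥ 1 and d ≥ 3 be integers. For p = 1,…,d let V_p = ℂ^n with standard basis v^p_1,…,v^p_n; let V_{d+1} = ℂ^{n^d} with standard basis {v^{d+1}_{(i₁,…,i_d)} : i_p ∈ [n]}; let W₁ = W₂ = ℂ^{n^d} with standard bases {w^1_{(j₁,…,j_d)}} and {w^2_{(j₁,…,j_d)}}; and for p = 3,…,d+1 let W_p = ℂ¹ spanned by w^p. For ε ∈ ℂ and (i₁,…,i_d) ∈ [n]^d define q_{i₁,…,i_d}(ε) = (v^1_{i₁} + ε^{d−1} w^1_{(i₁,…,i_d)}) ⊗ (v^2_{i₂} + ε^{d−1} w^2_{(i₁,…,i_d)}) ⊗ (ε v^3_{i₃} + w³) ⊗ ⋯ ⊗ (ε v^d_{i_d} + w^d) ⊗ (ε^d v^{d+1}_{(i₁,…,i_d)} + w^{d+1}) ∈ (V₁ ⊕ W₁) ⊗ ⋯ ⊗ (V_{d+1} ⊕ W_{d+1}), and let Q(ε) = Σ_{(i₁,…,i_d) ∈ [n]^d} q_{i₁,…,i_d}(ε), a polynomial in ε with coefficients in (V₁ ⊕ W₁) ⊗ ⋯ ⊗ (V_{d+1}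 ⊕ W_{d+1}). Then the coefficient of ε^{2d−2} in Q(ε) equals T₁ ⊕ T₂, where T₁ = Σ_{(i₁,…,i_d) ∈ [n]^d} v^1_{i₁} ⊗ ⋯ ⊗ v^d_{i_d} ⊗ v^{d+1}_{(i₁,…,i_d)} and T₂ = Σ_{(j₁,…,j_d) ∈ [n]^d} w^1_{(j₁,…,j_d)} ⊗ w^2_{(j₁,…,j_d)} ⊗ w³ ⊗ ⋯ ⊗ w^{d+1}. -/

import Mathlib

open Finset

namespace Subadditivity

noncomputable section

/-- A tensor of order `k` over `ℂ` with `i`-th factor the space `ℂ^{ι i}` of complex-valued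
functions on the finite index type `ι i`; the tensor is represented by the array of its
coordinates with respect to the standard basis, i.e. by an element of
`ℂ^{ι 0} ⊗ ⋯ ⊗ ℂ^{ι (k-1)} ≃ ((∀ i, ι i) → ℂ)`. -/
abbrev Tensor {k : ℕ} (ι : Fin k → Type) : Type := (∀ i, ι i) → ℂ

/-- `T` is a sum of `r` simple (rank-one) tensors `v j 0 ⊗ ⋯ ⊗ v j (k-1)`. -/
def HasRankLE {k : ℕ} {ι : Fin k → Type} (T : Tensor ι) (r : ℕ) : Prop :=
  ∃ v : Fin r → (∀ i, ι i → ℂ), T = fun x => ∑ j : Fin r, ∏ i : Fin k, v j i (x i)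

/-- Tensor rank: the least `r` such that `T` is a sum of `r` simple tensors. -/
noncomputable def rank {k : ℕ} {ι : Fin k → Type} (T : Tensor ι) : ℕ :=
  sInf {r | HasRankLE T r}

/-- Border rank is at most `r`: `T` lies in the closure of the set of tensors of rank `≤ r`. -/
def HasBorderRankLE {k : ℕ} {ι : Fin k → Type} (T : Tensor ι) (r : ℕ) : Prop :=
  T ∈ closure {S : Tensor ι | HasRankLE S r}

/-- Border rank. -/
noncomputable def borderRank {k : ℕ} {ι : Fin k → Type} (T : Tensor ι) : ℕ :=
  sInf {r | HasBorderRankLE T r}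

open scoped Classical in
/-- Direct sum of two tensors of order `k`: the coordinates supported on the `ι`-part are
those of `T`, the coordinates supported on the `κ`-part are those of `S`, and all mixed
coordinates vanish. -/
noncomputable def dsum {k : ℕ} {ι κ : Fin k → Type} (T : Tensor ι) (S : Tensor κ) :
    Tensor (fun i => ι i ⊕ κ i) := fun x =>
  (if h : ∃ y : ∀ i, ι i, x = fun i => Sum.inl (y i) then T h.choose else 0) +
  (if h : ∃ z : ∀ i, κ i, x = fun i => Sum.inr (z i) then S h.choose else 0)

/-- Kronecker product of two tensors of order `k`. -/
def kron {k : ℕ} {ι κ : Fin k → Type} (T : Tensor ι) (S : Tensor κ) :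
    Tensor (fun i => ι i × κ i) := fun x =>
  T (fun i => (x i).1) * S (fun i => (x i).2)

/-- `N`-th Kronecker power of a tensor of order `k`. -/
def kpow {k : ℕ} {ι : Fin k → Type} (T : Tensor ι) (N : ℕ) :
    Tensor (fun i => Fin N → ι i) := fun x => ∏ j : Fin N, T (fun i => x i j)

/-- The unit tensor `u_k(r) = Σ_{j=1}^r e_j ⊗ ⋯ ⊗ e_j` of order `k`. -/
def unit (k r : ℕ) : Tensor (fun _ : Fin k => Fin r) := fun x =>
  ∑ j : Fin r, ∏ i : Fin k, (if x i = j then (1 : ℂ) else 0)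

/-- `S` is a degeneration of `T`: `S` lies in the closure of the set of tensors obtained
from `T` by applying linear maps `A i` on each factor. -/
def Degen {k : ℕ} {ι κ : Fin k → Type} [∀ i, Fintype (κ i)]
    (S : Tensor ι) (T : Tensor κ) : Prop :=
  S ∈ closure {S' : Tensor ι | ∃ A : ∀ i, ι i → κ i → ℂ,
    S' = fun x => ∑ y : ∀ i, κ i, (∏ i : Fin k, A i (x i) (y i)) * T y}

/-- Kronecker delta. -/
def delta {α : Type} [DecidableEq α] (a b : α) : ℂ := if a = b then 1 else 0

/-- Factor index types of the order-`(d+1)` spider tensor: positions `0, …, d-1`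
carry `ℂ^n`, and position `d` carries `ℂ^{n^d}`, indexed by `d`-tuples. -/
def famV (n d : ℕ) : Fin (d + 1) → Type :=
  fun i => if (i : ℕ) < d then Fin n else (Fin d → Fin n)

def vlow {n d : ℕ} {i : Fin (d + 1)} (h : (i : ℕ) < d) (u : famV n d i) : Fin n :=
  cast (by simp [famV, h]) u

def vhigh {n d : ℕ} {i : Fin (d + 1)} (h : ¬ (i : ℕ) < d) (u : famV n d i) :
    Fin d → Fin n :=
  cast (by simp [famV, h]) u

/-- The order-`(d+1)` spider tensor
`T₁ = Σ_{i₁,…,i_d} e_{i₁} ⊗ ⋯ ⊗ e_{i_d} ⊗ e_{(i₁,…,i_d)} ∈ (ℂ^n)^{⊗d} ⊗ ℂ^{n^d}`. -/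
def bigSpider (n d : ℕ) : Tensor (famV n d) := fun x =>
  ∏ j : Fin d, delta (α := Fin n)
    (vlow (i := Fin.castSucc j) (by simp) (x (Fin.castSucc j)))
    (vhigh (i := Fin.last d) (by simp) (x (Fin.last d)) j)

/-- Factor index types of the order-`(d+1)` tensor `T₂`: positions `0, 1` carry `ℂ^N`,
all other positions carry `ℂ¹`. -/
def famW (N d : ℕ) : Fin (d + 1) → Type :=
  fun i => if (i : ℕ) < 2 then Fin N else Fin 1

def wlow {N d : ℕ} {i : Fin (d + 1)} (h : (i : ℕ) < 2) (u : famW N d i) : Fin N :=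
  cast (by simp [famW, h]) u

/-- The order-`(d+1)` tensor `T₂ = Σ_{j=1}^N e_j ⊗ e_j ⊗ e₀ ⊗ ⋯ ⊗ e₀ ∈ ℂ^N ⊗ ℂ^N ⊗ ℂ¹ ⊗ ⋯ ⊗ ℂ¹`. -/
def bigMat (N d : ℕ) (hd : 1 ≤ d) : Tensor (famW N d) := fun x =>
  delta (α := Fin N)
    (wlow (i := (⟨0, Nat.succ_pos d⟩ : Fin (d + 1))) (by simp) (x ⟨0, Nat.succ_pos d⟩))
    (wlow (i := (⟨1, by omega⟩ : Fin (d + 1))) (by simp) (x ⟨1, by omega⟩))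

/-- Factor index types of the order-`(d+1)` tensor `T₂` of Construction 3 with
`N = n^d`: positions `0, 1` carry `ℂ^{n^d}`, indexed by `d`-tuples, and all other
positions carry `ℂ¹`. These are also the `W`-factors of the direct sum. -/
def famWt (n d : ℕ) : Fin (d + 1) → Type :=
  fun i => if (i : ℕ) < 2 then (Fin d → Fin n) else Fin 1

def wtlow {n d : ℕ} {i : Fin (d + 1)} (h : (i : ℕ) < 2) (u : famWt n d i) :
    Fin d → Fin n :=
  cast (by simp [famWt, h]) u

/-- The order-`(d+1)` tensor
`T₂ = Σ_{(j₁,…,j_d)} w¹_{(j₁,…,j_d)} ⊗ w²_{(j₁,…,j_d)} ⊗ w³ ⊗ ⋯ ⊗ w^{d+1}`. -/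
def bigW (n d : ℕ) (hd : 1 ≤ d) : Tensor (famWt n d) := fun x =>
  delta (α := Fin d → Fin n)
    (wtlow (i := (⟨0, Nat.succ_pos d⟩ : Fin (d + 1))) (by simp) (x ⟨0, Nat.succ_pos d⟩))
    (wtlow (i := (⟨1, by omega⟩ : Fin (d + 1))) (by simp) (x ⟨1, by omega⟩))

/-- The `i`-th factor of the rank-one tensor `q_{i₁,…,i_d}(ε)`, as a vector with
polynomial (in `ε`) coordinates on the `i`-th factor `V_i ⊕ W_i` of the direct sum:
* position `0` carries `v¹_{i₁} + ε^{d−1} w¹_{(i₁,…,i_d)}`,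
* position `1` carries `v²_{i₂} + ε^{d−1} w²_{(i₁,…,i_d)}`,
* positions `2, …, d−1` carry `ε v^p_{i_p} + w^p`,
* position `d` carries `ε^d v^{d+1}_{(i₁,…,i_d)} + w^{d+1}`. -/
def qFactor (n d : ℕ) (a : Fin d → Fin n) (i : Fin (d + 1)) :
    famV n d i ⊕ famWt n d i → Polynomial ℂ :=
  Sum.elim
    (fun u =>
      if h : (i : ℕ) < d then
        (if vlow h u = a ⟨(i : ℕ), h⟩ then
          (if (i : ℕ) < 2 then 1 else Polynomial.X) else 0)
      else
        (if vhigh h u = a then Polynomial.X ^ d else 0))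
    (fun w =>
      if h : (i : ℕ) < 2 then
        (if wtlow h w = a then Polynomial.X ^ (d - 1) else 0)
      else 1)

/-- `Q(ε) = Σ_{(i₁,…,i_d) ∈ [n]^d} q_{i₁,…,i_d}(ε)`, as a tensor with polynomial
coordinates: each coordinate of `Q` is a polynomial in `ε`. -/
def Qpoly (n d : ℕ) : (∀ i, famV n d i ⊕ famWt n d i) → Polynomial ℂ := fun x =>
  ∑ a : Fin d → Fin n, ∏ i : Fin (d + 1), qFactor n d a i (x i)

/-- The scalar part of the monomial `qFactor n d a i u`. -/
def qScalar (n d : ℕ) (a : Fin d → Fin n) (i : Fin (d + 1)) :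
    famV n d i ⊕ famWt n d i → ℂ :=
  Sum.elim
    (fun u => if h : (i : ℕ) < d then delta (vlow h u) (a ⟨(i : ℕ), h⟩)
      else delta (vhigh h u) a)
    (fun w => if h : (i : ℕ) < 2 then delta (wtlow h w) a else 1)

/-- The exponent of the monomials on the `V`-part (`b = true`) or on the `W`-part (`b = false`)
of the `i`-th factor. -/
def qExponent (d i : ℕ) (b : Bool) : ℕ :=
  if b then (if i < 2 then 0 else if i < d then 1 else d) else (if i < 2 then d - 1 else 0)

theorem qFactor_eq_C_mul_X_pow (n d : ℕ) (hd : 2 ≤ d) (a : Fin d → Fin n) (i : Fin (d + 1))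
    (u : famV n d i ⊕ famWt n d i) :
    qFactor n d a i u =
      Polynomial.C (qScalar n d a i u) * Polynomial.X ^ qExponent d i u.isLeft := by
  rcases u with u | u
  · by_cases h : (i : ℕ) < d
    · by_cases h2 : (i : ℕ) < 2 <;> simp [qFactor, qScalar, qExponent, delta, h, h2]
    · have h2 : ¬ (i : ℕ) < 2 := by omega
      simp [qFactor, qScalar, qExponent, delta, h, h2]
  · by_cases h2 : (i : ℕ) < 2 <;> simp [qFactor, qScalar, qExponent, delta, h2]

theorem coeff_Qpoly_eq_ite (n d : ℕ) (hd : 2 ≤ d) (x : ∀ i, famV n d i ⊕ famWt n d i) (k : ℕ) :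
    (Qpoly n d x).coeff k =
      if k = ∑ i : Fin (d + 1), qExponent d i (x i).isLeft then
        ∑ a : Fin d → Fin n, ∏ i, qScalar n d a i (x i) else 0 := by
  simp only [Qpoly, qFactor_eq_C_mul_X_pow n d hd, Finset.prod_mul_distrib,
    Finset.prod_pow_eq_pow_sum, ← map_prod, Polynomial.finsetSum_coeff,
    Polynomial.coeff_C_mul_X_pow]
  split_ifs <;> simp

/-- The exponent `2d - 2` is attained only when all positions lie on the same side. -/
theorem sum_qExponent_eq_iff (d : ℕ) (hd : 2 ≤ d) (b : Fin (d + 1) → Bool) :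
    2 * d - 2 = ∑ i : Fin (d + 1), qExponent d i (b i) ↔
      (∀ i, b i = true) ∨ ∀ i, b i = false := by
  obtain ⟨m, rfl⟩ := Nat.exists_eq_add_of_le' hd
  have key : ∑ i : Fin (m + 2 + 1), qExponent (m + 2) i (b i) =
      (if b 0 then 0 else m + 1) + ((if b 1 then 0 else m + 1) +
        (#{i : Fin m | b i.castSucc.succ.succ = true} +
          if b (Fin.last _) then m + 2 else 0)) := by
    rw [Fin.sum_univ_succ, Fin.sum_univ_succ, Fin.sum_univ_castSucc, Finset.card_filter]
    simp [qExponent]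
  have hle : #{i : Fin m | b i.castSucc.succ.succ = true} ≤ m := by
    simpa using Finset.card_filter_le (univ : Finset (Fin m)) fun i => b i.castSucc.succ.succ = true
  have hall (c : Bool) : (∀ i, b i = c) ↔ b 0 = c ∧ b 1 = c ∧
      (∀ i : Fin m, b i.castSucc.succ.succ = c) ∧ b (Fin.last _) = c := by
    rw [Fin.forall_fin_succ, Fin.forall_fin_succ, Fin.forall_fin_succ']
    simp
  have htrue : #{i : Fin m | b i.castSucc.succ.succ = true} = m ↔
      ∀ i : Fin m, b i.castSucc.succ.succ = true := by
    simpa using Finset.card_filter_eq_iff (s := (univ : Finset (Fin m)))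
      (p := fun i => b i.castSucc.succ.succ = true)
  have hfalse : #{i : Fin m | b i.castSucc.succ.succ = true} = 0 ↔
      ∀ i : Fin m, b i.castSucc.succ.succ = false := by
    simp [Finset.filter_eq_empty_iff]
  rw [key, hall, hall, ← htrue, ← hfalse]
  generalize #{i : Fin m | b i.castSucc.succ.succ = true} = s at hle ⊢
  cases b 0 <;> cases b 1 <;> cases b (Fin.last _) <;> simp <;> omega

theorem dsum_inl {k : ℕ} {ι κ : Fin (k + 1) → Type} (T : Tensor ι) (S : Tensor κ)
    (y : ∀ i, ι i) : dsum T S (fun i => Sum.inl (y i)) = T y := by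
  have h : ∃ y' : ∀ i, ι i,
      (fun i => Sum.inl (y i) : ∀ i, ι i ⊕ κ i) = fun i => Sum.inl (y' i) := ⟨y, rfl⟩
  have h' : ¬ ∃ z : ∀ i, κ i,
      (fun i => Sum.inl (y i) : ∀ i, ι i ⊕ κ i) = fun i => Sum.inr (z i) := by
    rintro ⟨z, hz⟩
    simpa using congrFun hz 0
  have hy : h.choose = y := funext fun i => (Sum.inl.inj (congrFun h.choose_spec i)).symm
  rw [dsum, dif_pos h, dif_neg h', hy, add_zero]

theorem dsum_inr {k : ℕ} {ι κ : Fin (k + 1) → Type} (T : Tensor ι) (S : Tensor κ)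
    (z : ∀ i, κ i) : dsum T S (fun i => Sum.inr (z i)) = S z := by
  have h : ∃ z' : ∀ i, κ i,
      (fun i => Sum.inr (z i) : ∀ i, ι i ⊕ κ i) = fun i => Sum.inr (z' i) := ⟨z, rfl⟩
  have h' : ¬ ∃ y : ∀ i, ι i,
      (fun i => Sum.inr (z i) : ∀ i, ι i ⊕ κ i) = fun i => Sum.inl (y i) := by
    rintro ⟨y, hy⟩
    simpa using congrFun hy 0
  have hz : h.choose = z := funext fun i => (Sum.inr.inj (congrFun h.choose_spec i)).symm
  rw [dsum, dif_neg h', dif_pos h, hz, zero_add]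

theorem dsum_eq_zero {k : ℕ} {ι κ : Fin k → Type} (T : Tensor ι) (S : Tensor κ)
    (x : ∀ i, ι i ⊕ κ i) (hl : ¬ ∀ i, (x i).isLeft = true) (hr : ¬ ∀ i, (x i).isLeft = false) :
    dsum T S x = 0 := by
  rw [dsum, dif_neg, dif_neg, add_zero]
  · rintro ⟨z, rfl⟩
    simp at hr
  · rintro ⟨y, rfl⟩
    simp at hl

theorem sum_prod_qScalar_inl (n d : ℕ) (y : ∀ i, famV n d i) :
    ∑ a : Fin d → Fin n, ∏ i, qScalar n d a i (Sum.inl (y i)) = bigSpider n d y := by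
  rw [Finset.sum_eq_single (vhigh (i := Fin.last d) (by simp) (y (Fin.last d)))]
  · rw [Fin.prod_univ_castSucc]
    simp [qScalar, bigSpider, delta]
  · intro a _ ha
    apply Finset.prod_eq_zero (mem_univ (Fin.last d))
    simp [qScalar, delta, ha.symm]
  · simp

theorem sum_prod_qScalar_inr (n d : ℕ) (hd : 1 ≤ d) (z : ∀ i, famWt n d i) :
    ∑ a : Fin d → Fin n, ∏ i, qScalar n d a i (Sum.inr (z i)) = bigW n d hd z := by
  obtain ⟨m, rfl⟩ := Nat.exists_eq_add_of_le' hd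
  simp only [Fin.prod_univ_succ]
  simp [qScalar, delta, bigW]
  exact if_congr eq_comm rfl rfl

/-- the key claim in the proof of Theorem: Construction 3.
The coefficient of `ε^{2d−2}` in `Q(ε)` equals `T₁ ⊕ T₂`, where `T₁` is the
order-`(d+1)` spider tensor and `T₂ = Σ_{(j₁,…,j_d)} w¹ ⊗ w² ⊗ w³ ⊗ ⋯ ⊗ w^{d+1}`. -/
theorem coeff_Qpoly (n d : ℕ) (hn : 1 ≤ n) (hd : 3 ≤ d)
    (x : ∀ i, famV n d i ⊕ famWt n d i) :
    (Qpoly n d x).coeff (2 * d - 2) =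
      dsum (bigSpider n d) (bigW n d (by omega)) x := by
  obtain ⟨m, rfl⟩ := Nat.exists_eq_add_of_le' hd
  rw [coeff_Qpoly_eq_ite n _ (by omega)]
  simp only [sum_qExponent_eq_iff _ (by omega : 2 ≤ m + 3) fun i => (x i).isLeft]
  by_cases hl : ∀ i, (x i).isLeft = true
  · rw [if_pos (Or.inl hl)]
    choose y hy using fun i => Sum.isLeft_iff.1 (hl i)
    obtain rfl : x = fun i => Sum.inl (y i) := funext hy
    rw [dsum_inl, sum_prod_qScalar_inl]
  by_cases hr : ∀ i, (x i).isLeft = false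
  · rw [if_pos (Or.inr hr)]
    choose z hz using fun i => Sum.isRight_iff.1 (Sum.isLeft_eq_false.1 (hr i))
    obtain rfl : x = fun i => Sum.inr (z i) := funext hz
    rw [dsum_inr, sum_prod_qScalar_inr]
  · rw [if_neg (not_or.2 ⟨hl, hr⟩), dsum_eq_zero _ _ _ hl hr]

end
end Subadditivity
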